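/- arXiv:1710.02981 — 2 statements merged into one kernel-verified Lean document; each statement's English description precedes it below -/
import Mathlib

section
/- Let α > 0 and let T be an absolutely (C,α)-Cesàro bounded operator on a reflexive complex Banach space X. Then T is (C,α)-mean ergodic, i.e. for every x ∈ X the sequence (M_T^α(n) x)_{n ∈ ℕ₀} converges in X as n → ∞. -/
open Filter
open scoped ENNReal

/-- The Cesàro kernel of order `α`: `k^α(n) = Γ(α+n) / (Γ(α)·Γ(n+1))`. -/
noncomputable def cesKernel (α : ℝ) (n : ℕ) : ℝ :=
  Real.Gamma (α + n) / (Real.Gamma α * Real.Gamma (n + 1))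

/-- A bounded linear operator `T` on a complex Banach space is absolutely `(C,α)`-Cesàro
bounded if there is `C > 0` with
`(1/k^{α+1}(n)) · Σ_{j=0}^n k^α(n-j) ‖T^j x‖ ≤ C ‖x‖` for all `n` and `x`. -/
def AbsCesaroBounded {X : Type*} [NormedAddCommGroup X] [NormedSpace ℂ X]
    (α : ℝ) (T : X →L[ℂ] X) : Prop :=
  ∃ C : ℝ, 0 < C ∧ ∀ (n : ℕ) (x : X),
    (cesKernel (α + 1) n)⁻¹ *
      ∑ j ∈ Finset.range (n + 1), cesKernel α (n - j) * ‖(T ^ j) x‖ ≤ C * ‖x‖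

/-- The Cesàro mean of order `α` of `T`:
`M_T^α(n) = (1/k^{α+1}(n)) · Σ_{j=0}^n k^α(n-j) T^j`. -/
noncomputable def cesMean {X : Type*} [NormedAddCommGroup X] [NormedSpace ℂ X]
    (α : ℝ) (T : X →L[ℂ] X) (n : ℕ) : X →L[ℂ] X :=
  (((cesKernel (α + 1) n)⁻¹ : ℝ) : ℂ) •
    ∑ j ∈ Finset.range (n + 1), ((cesKernel α (n - j) : ℝ) : ℂ) • T ^ j

theorem ck_pos {α : ℝ} (hα : 0 < α) (n : ℕ) : 0 < cesKernel α n := by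
  unfold cesKernel
  have h1 : 0 < Real.Gamma (α + n) := Real.Gamma_pos_of_pos (by positivity)
  have h2 : 0 < Real.Gamma α := Real.Gamma_pos_of_pos hα
  have h3 : 0 < Real.Gamma ((n : ℝ) + 1) := Real.Gamma_pos_of_pos (by positivity)
  positivity

theorem ck_zero {α : ℝ} (hα : 0 < α) : cesKernel α 0 = 1 := by
  unfold cesKernel
  have h2 : 0 < Real.Gamma α := Real.Gamma_pos_of_pos hα
  simp [h2.ne']

theorem ck_succ {α : ℝ} (hα : 0 < α) (n : ℕ) :
    cesKernel α (n + 1) * (n + 1) = cesKernel α n * (α + n) := by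
  unfold cesKernel
  have h2 : 0 < Real.Gamma α := Real.Gamma_pos_of_pos hα
  have h3 : 0 < Real.Gamma ((n : ℝ) + 1) := Real.Gamma_pos_of_pos (by positivity)
  have e1 : Real.Gamma (α + ((n + 1 : ℕ) : ℝ)) = (α + n) * Real.Gamma (α + n) := by
    rw [← Real.Gamma_add_one (by positivity)]; push_cast; ring_nf
  have e2 : Real.Gamma (((n + 1 : ℕ) : ℝ) + 1) = (n + 1) * Real.Gamma ((n : ℝ) + 1) := by
    rw [← Real.Gamma_add_one (by positivity)]; push_cast; ring_nf
  rw [e1, e2]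
  field_simp

theorem ck_up {α : ℝ} (hα : 0 < α) (n : ℕ) :
    cesKernel (α + 1) n * α = cesKernel α n * (α + n) := by
  unfold cesKernel
  have h2 : 0 < Real.Gamma α := Real.Gamma_pos_of_pos hα
  have h3 : 0 < Real.Gamma ((n : ℝ) + 1) := Real.Gamma_pos_of_pos (by positivity)
  have e1 : Real.Gamma (α + 1 + (n : ℝ)) = (α + n) * Real.Gamma (α + n) := by
    rw [← Real.Gamma_add_one (by positivity)]; ring_nf
  rw [e1, Real.Gamma_add_one hα.ne']
  field_simp

theorem ck_sum {α : ℝ} (hα : 0 < α) (n : ℕ) :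
    ∑ j ∈ Finset.range (n + 1), cesKernel α j = cesKernel (α + 1) n := by
  induction n with
  | zero => simp [ck_zero hα, ck_zero (show 0 < α + 1 by linarith)]
  | succ n ih =>
    rw [Finset.sum_range_succ, ih]
    have h1 := ck_succ hα n
    have h2 := ck_up hα n
    have h3 := ck_up hα (n + 1)
    push_cast at h3
    apply mul_right_cancel₀ hα.ne'
    rw [h3, add_mul, h2, ← h1]; ring

theorem ck_mono {α : ℝ} (hα : 0 < α) : Monotone (cesKernel (α + 1)) := by
  apply monotone_nat_of_le_succ
  intro n
  rw [← ck_sum hα, ← ck_sum hα, Finset.sum_range_succ _ (n + 1)]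
  have := ck_pos hα (n + 1)
  linarith

theorem harm_tendsto {α : ℝ} (hα : 0 < α) :
    Tendsto (fun n : ℕ => ∑ m ∈ Finset.range (n + 1), α / (α + m)) atTop atTop := by
  have h0 := (Real.tendsto_sum_range_one_div_nat_succ_atTop.comp
    (tendsto_add_atTop_nat 1)).const_mul_atTop (show 0 < α / (α + 1) by positivity)
  refine tendsto_atTop_mono (fun n => ?_) h0
  simp only [Function.comp]
  rw [Finset.mul_sum]
  refine Finset.sum_le_sum fun m _ => ?_
  rw [div_mul_div_comm, mul_one]
  apply div_le_div_of_nonneg_left hα.le (by positivity)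
  have : (0 : ℝ) ≤ m := by positivity
  nlinarith

section
variable {X : Type*} [NormedAddCommGroup X] [NormedSpace ℂ X]

theorem growth {α : ℝ} (hα : 0 < α) (T : X →L[ℂ] X) {C : ℝ} (hC : 0 < C)
    (hT : ∀ (n : ℕ) (x : X), ∑ m ∈ Finset.range (n + 1), cesKernel α m * ‖(T ^ (n - m)) x‖
      ≤ C * cesKernel (α + 1) n * ‖x‖) (x : X) :
    Tendsto (fun n : ℕ => ‖(T ^ n) x‖ / cesKernel (α + 1) n) atTop (nhds 0) := by
  have hK : ∀ n, 0 < cesKernel (α + 1) n := ck_pos (by linarith)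
  have hb : ∀ (n : ℕ) (y : X), ‖(T ^ n) y‖ ≤ C * cesKernel (α + 1) n * ‖y‖ := by
    intro n y
    refine le_trans ?_ (hT n y)
    have := Finset.single_le_sum (f := fun m => cesKernel α m * ‖(T ^ (n - m)) y‖)
      (s := Finset.range (n + 1)) (fun i _ => mul_nonneg (ck_pos hα i).le (norm_nonneg _))
      (show 0 ∈ Finset.range (n + 1) by simp)
    simpa [ck_zero hα] using this
  have hlim : Tendsto (fun n : ℕ => C * C * ‖x‖ / ∑ m ∈ Finset.range (n + 1), α / (α + m))
      atTop (nhds 0) := (harm_tendsto hα).const_div_atTop _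
  refine squeeze_zero (fun n => div_nonneg (norm_nonneg _) (hK n).le) (fun n => ?_) hlim
  have hS : 0 < ∑ m ∈ Finset.range (n + 1), α / (α + m) :=
    Finset.sum_pos (fun m _ => by positivity) ⟨0, by simp⟩
  rw [div_le_div_iff₀ (hK n) hS, Finset.mul_sum]
  calc ∑ m ∈ Finset.range (n + 1), ‖(T ^ n) x‖ * (α / (α + m))
      ≤ ∑ m ∈ Finset.range (n + 1), C * (cesKernel α m * ‖(T ^ (n - m)) x‖) := by
        refine Finset.sum_le_sum fun m hm => ?_
        have hm' : m ≤ n := by simpa [Nat.lt_succ_iff] using hm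
        have h1 := hb m ((T ^ (n - m)) x)
        have h2 : (T ^ m) ((T ^ (n - m)) x) = (T ^ n) x := by
          rw [← ContinuousLinearMap.mul_apply, ← pow_add]; congr 2; omega
        rw [h2] at h1
        have hp : 0 < α + m := by positivity
        have h3 := ck_up hα m
        have h4 : cesKernel α m = cesKernel (α + 1) m * (α / (α + m)) := by
          field_simp; linarith
        rw [h4]
        calc _ ≤ (C * cesKernel (α + 1) m * ‖(T ^ (n - m)) x‖) * (α / (α + m)) := by gcongr
          _ = _ := by ring
    _ = C * ∑ m ∈ Finset.range (n + 1), (cesKernel α m * ‖(T ^ (n - m)) x‖) := by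
        rw [Finset.mul_sum]
    _ ≤ C * (C * cesKernel (α + 1) n * ‖x‖) := by gcongr; exact hT n x
    _ = _ := by ring

theorem conv_small {k e a K : ℕ → ℝ} {B : ℝ} (hB : 0 < B) (hk : ∀ n, 0 ≤ k n) (hK : ∀ n, 0 < K n)
    (hKm : Monotone K) (ha : ∀ n, 0 ≤ a n) (he0 : ∀ n, 0 ≤ e n)
    (he : Tendsto e atTop (nhds 0)) (haK : Tendsto (fun n => a n / K n) atTop (nhds 0))
    (hs : ∀ n, ∑ m ∈ Finset.range (n + 1), k m * a (n - m) ≤ B * K n) :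
    Tendsto (fun n => (∑ m ∈ Finset.range (n + 1), k m * e m * a (n - m)) / K n)
      atTop (nhds 0) := by
  rw [Metric.tendsto_atTop]
  intro ε hε
  obtain ⟨N, hN⟩ := (Metric.tendsto_atTop.1 he) (ε / (2 * B)) (by positivity)
  have hfin : Tendsto (fun n => ∑ m ∈ Finset.range N, k m * e m * (a (n - m) / K (n - m)))
      atTop (nhds 0) := by
    have : Tendsto (fun n => ∑ m ∈ Finset.range N, k m * e m * (a (n - m) / K (n - m)))
      atTop (nhds (∑ m ∈ Finset.range N, k m * e m * 0)) := by
      refine tendsto_finsetSum _ fun m _ => ?_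
      exact (haK.comp (tendsto_sub_atTop_nat m)).const_mul _
    simpa using this
  obtain ⟨N', hN'⟩ := (Metric.tendsto_atTop.1 hfin) (ε / 2) (by positivity)
  refine ⟨max N N', fun n hn => ?_⟩
  have hnN : N ≤ n := le_trans (le_max_left _ _) hn
  have h1 := hN' n (le_trans (le_max_right _ _) hn)
  rw [Real.dist_eq, sub_zero] at h1 ⊢
  have hnn : 0 ≤ (∑ m ∈ Finset.range (n + 1), k m * e m * a (n - m)) / K n :=
    div_nonneg (Finset.sum_nonneg fun m _ =>
      mul_nonneg (mul_nonneg (hk m) (he0 m)) (ha _)) (hK n).le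
  rw [abs_of_nonneg hnn, div_lt_iff₀ (hK n)]
  have h2 := lt_of_le_of_lt (le_abs_self _) h1
  have hsplit : ∑ m ∈ Finset.range (n + 1), k m * e m * a (n - m)
      ≤ (∑ m ∈ Finset.range N, k m * e m * (a (n - m) / K (n - m))) * K n
        + ε / (2 * B) * ∑ m ∈ Finset.range (n + 1), k m * a (n - m) := by
    rw [Finset.sum_mul, Finset.mul_sum,
      ← Finset.sum_range_add_sum_Ico _ (show N ≤ n + 1 by omega)]
    refine add_le_add ?_ ?_
    · refine Finset.sum_le_sum fun m _ => ?_
      rw [mul_assoc (k m * e m)]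
      refine mul_le_mul_of_nonneg_left ?_ (mul_nonneg (hk m) (he0 m))
      rw [div_mul_eq_mul_div, le_div_iff₀ (hK _)]
      exact mul_le_mul_of_nonneg_left (hKm (Nat.sub_le _ _)) (ha _)
    · rw [← Finset.sum_range_add_sum_Ico (fun m => ε / (2 * B) * (k m * a (n - m)))
        (show N ≤ n + 1 by omega)]
      refine le_trans (Finset.sum_le_sum fun m hm => ?_)
        (le_add_of_nonneg_left (Finset.sum_nonneg fun m _ => ?_))
      · have hm' := hN m (Finset.mem_Ico.1 hm).1
        rw [Real.dist_eq, sub_zero] at hm'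
        have h3 := (le_abs_self _).trans hm'.le
        have h4 := mul_le_mul_of_nonneg_right h3 (mul_nonneg (hk m) (ha (n - m)))
        linarith
      · have := mul_nonneg (hk m) (ha (n - m)); positivity
  have h5 : ε / (2 * B) * ∑ m ∈ Finset.range (n + 1), k m * a (n - m) ≤ ε / 2 * K n := by
    calc _ ≤ ε / (2 * B) * (B * K n) := by gcongr; exact hs n
      _ = _ := by field_simp
  have h6 := mul_lt_mul_of_pos_right h2 (hK n)
  linarith

theorem cesMean_apply' (α : ℝ) (T : X →L[ℂ] X) (n : ℕ) (x : X) :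
    cesMean α T n x = (((cesKernel (α + 1) n)⁻¹ : ℝ) : ℂ) •
      ∑ m ∈ Finset.range (n + 1), ((cesKernel α m : ℝ) : ℂ) • (T ^ (n - m)) x := by
  unfold cesMean
  rw [← Finset.sum_range_reflect (fun j => ((cesKernel α (n - j) : ℝ) : ℂ) • T ^ j)]
  simp only [ContinuousLinearMap.smul_apply, ContinuousLinearMap.sum_apply]
  congr 1
  refine Finset.sum_congr rfl fun m hm => ?_
  have hm' : m ≤ n := by simpa [Nat.lt_succ_iff] using hm
  have e1 : n + 1 - 1 - m = n - m := by omega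
  have e2 : n - (n - m) = m := by omega
  rw [e1, e2]

theorem diff_bound {α : ℝ} (hα : 0 < α) (T : X →L[ℂ] X) (x : X) (n : ℕ) :
    ‖∑ m ∈ Finset.range (n + 1), ((cesKernel α m : ℝ) : ℂ) • (T ^ (n - m)) (x - T x)‖ ≤
      cesKernel α n * ‖x‖ + ‖T‖ * ‖(T ^ n) x‖ +
        ∑ m ∈ Finset.range (n + 1), cesKernel α m * (|α - 1| / (m + 1)) * ‖(T ^ (n - m)) x‖ := by
  have hkey : ∑ m ∈ Finset.range (n + 1), ((cesKernel α m : ℝ) : ℂ) • (T ^ (n - m)) (x - T x)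
      = ((cesKernel α n : ℝ) : ℂ) • x - T ((T ^ n) x) -
        ∑ m ∈ Finset.range n, ((cesKernel α (m + 1) - cesKernel α m : ℝ) : ℂ) •
          (T ^ (n - m)) x := by
    have hp : ∀ j, (T ^ j) (T x) = (T ^ (j + 1)) x := fun j => by
      rw [pow_succ]; rfl
    have hp' : T ((T ^ n) x) = (T ^ (n + 1)) x := by rw [pow_succ']; rfl
    simp only [map_sub, smul_sub, Finset.sum_sub_distrib, Complex.ofReal_sub, sub_smul, hp, hp']
    rw [Finset.sum_range_succ, Finset.sum_range_succ' (fun m => ((cesKernel α m : ℝ) : ℂ) •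
      (T ^ (n - m + 1)) x)]
    have : ∑ m ∈ Finset.range n, ((cesKernel α (m + 1) : ℝ) : ℂ) • (T ^ (n - (m + 1) + 1)) x
        = ∑ m ∈ Finset.range n, ((cesKernel α (m + 1) : ℝ) : ℂ) • (T ^ (n - m)) x := by
      refine Finset.sum_congr rfl fun m hm => ?_
      have := Finset.mem_range.1 hm
      congr 3; omega
    rw [this, ck_zero hα]
    simp
    abel
  rw [hkey]
  refine (norm_sub_le _ _).trans (add_le_add ((norm_sub_le _ _).trans (add_le_add ?_ ?_)) ?_)
  · rw [norm_smul, Complex.norm_real, Real.norm_of_nonneg (ck_pos hα n).le]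
  · exact T.le_opNorm _
  · refine (norm_sum_le _ _).trans ?_
    rw [Finset.sum_range_succ]
    refine le_trans (Finset.sum_le_sum fun m _ => ?_) (le_add_of_nonneg_right ?_)
    · rw [norm_smul, Complex.norm_real, Real.norm_eq_abs]
      refine mul_le_mul_of_nonneg_right (le_of_eq ?_) (norm_nonneg _)
      have h := ck_succ hα m
      have hm : (0 : ℝ) < m + 1 := by positivity
      have : cesKernel α (m + 1) - cesKernel α m = cesKernel α m * ((α - 1) / (m + 1)) := by
        field_simp; linarith
      rw [this, abs_mul, abs_div, abs_of_pos (ck_pos hα m), abs_of_pos hm]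
    · have := (ck_pos hα n).le; positivity

theorem mean_diff {α : ℝ} (hα : 0 < α) (T : X →L[ℂ] X) {C : ℝ} (hC : 0 < C)
    (hT : ∀ (n : ℕ) (x : X), ∑ m ∈ Finset.range (n + 1), cesKernel α m * ‖(T ^ (n - m)) x‖
      ≤ C * cesKernel (α + 1) n * ‖x‖) (x : X) :
    Tendsto (fun n : ℕ => cesMean α T n (x - T x)) atTop (nhds 0) := by
  have hK : ∀ n, 0 < cesKernel (α + 1) n := ck_pos (by linarith)
  have hg := growth hα T hC hT x
  have ht : Tendsto (fun n : ℕ => |α - 1| / ((n : ℝ) + 1)) atTop (nhds 0) :=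
    (tendsto_natCast_atTop_atTop.atTop_add tendsto_const_nhds).const_div_atTop _
  have ht2 : Tendsto (fun n : ℕ => α / (α + (n : ℝ))) atTop (nhds 0) :=
    (tendsto_const_nhds.add_atTop tendsto_natCast_atTop_atTop).const_div_atTop _
  have h3 := conv_small (k := cesKernel α) (e := fun m : ℕ => |α - 1| / ((m : ℝ) + 1))
    (a := fun n => ‖(T ^ n) x‖) (K := cesKernel (α + 1)) (B := C * (‖x‖ + 1)) (by positivity)
    (fun n => (ck_pos hα n).le) hK (ck_mono hα) (fun n => norm_nonneg _)
    (fun n => by positivity) ht hg (fun n => (hT n x).trans (by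
      have := hK n
      nlinarith [mul_pos hC this]))
  have hsum := ((ht2.mul_const ‖x‖).add (hg.const_mul ‖T‖)).add h3
  simp only [zero_mul, mul_zero, add_zero] at hsum
  refine squeeze_zero_norm (fun n => ?_) hsum
  rw [cesMean_apply', norm_smul, Complex.norm_real, Real.norm_of_nonneg (inv_nonneg.2 (hK n).le)]
  refine (mul_le_mul_of_nonneg_left (diff_bound hα T x n) (inv_nonneg.2 (hK n).le)).trans
    (le_of_eq ?_)
  have hp : 0 < α + n := by positivity
  have h4 : α / (α + n) = cesKernel α n / cesKernel (α + 1) n := by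
    rw [div_eq_div_iff hp.ne' (hK n).ne', ← ck_up hα n]; ring
  rw [h4]
  ring

theorem mean_fix {α : ℝ} (hα : 0 < α) (T : X →L[ℂ] X) {Y : Type*} [NormedAddCommGroup Y]
    [NormedSpace ℂ Y] (f : X →L[ℂ] Y) (x : X)
    (h : ∀ j, f ((T ^ j) x) = f x) (n : ℕ) : f (cesMean α T n x) = f x := by
  have hK : 0 < cesKernel (α + 1) n := ck_pos (by linarith) n
  rw [cesMean_apply']
  simp only [map_smul, map_sum, h]
  rw [← Finset.sum_smul, ← Complex.ofReal_sum, ck_sum hα, smul_smul, ← Complex.ofReal_mul,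
    inv_mul_cancel₀ hK.ne']
  simp

theorem mem_closure_of_dual (S : Submodule ℂ X) (x : X)
    (h : ∀ f : X →L[ℂ] ℂ, (∀ s ∈ S, f s = 0) → f x = 0) : x ∈ S.topologicalClosure := by
  haveI : IsClosed (S.topologicalClosure : Set X) := S.isClosed_topologicalClosure
  rw [← Submodule.Quotient.mk_eq_zero]
  apply SeparatingDual.eq_zero_of_forall_dual_eq_zero (R := ℂ)
  intro g
  refine h (g.comp S.topologicalClosure.mkQL) fun s hs => ?_
  have : (Submodule.Quotient.mk s : X ⧸ S.topologicalClosure) = 0 :=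
    (Submodule.Quotient.mk_eq_zero _).2 (S.le_topologicalClosure hs)
  change g (Submodule.Quotient.mk s) = 0
  rw [this, map_zero]

theorem weak_cluster (hrefl : Function.Surjective (NormedSpace.inclusionInDoubleDual ℂ X))
    (u : ℕ → X) (B : ℝ) (hu : ∀ n, ‖u n‖ ≤ B) (U : Ultrafilter ℕ) :
    ∃ y : X, ∀ f : X →L[ℂ] ℂ, Tendsto (fun n => f (u n)) U (nhds (f y)) := by
  let J : ℕ → WeakDual ℂ (StrongDual ℂ X) := fun n =>
    StrongDual.toWeakDual (NormedSpace.inclusionInDoubleDual ℂ X (u n))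
  have hc := WeakDual.isCompact_closedBall (𝕜 := ℂ) (E := StrongDual ℂ X) 0 B
  obtain ⟨φ, -, hφ⟩ := hc.ultrafilter_le_nhds (U.map J) (by
    rw [le_principal_iff]
    refine Filter.univ_mem' (f := (U : Filter ℕ)) fun n => ?_
    change NormedSpace.inclusionInDoubleDual ℂ X (u n) ∈ Metric.closedBall 0 B
    refine (mem_closedBall_zero_iff (E := StrongDual ℂ (StrongDual ℂ X))).2 ?_
    exact (NormedSpace.double_dual_bound ℂ X (u n)).trans (hu n))
  obtain ⟨y, hy⟩ := hrefl (WeakDual.toStrongDual φ)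
  refine ⟨y, fun f => ?_⟩
  have h1 : Tendsto J U (nhds φ) := hφ
  have h2 := ((WeakDual.eval_continuous f).tendsto φ).comp h1
  have h3 : f y = φ f := by
    rw [← NormedSpace.dual_def, hy]; rfl
  rw [h3]
  exact h2

end

/-- Let `α > 0` and `T` be absolutely `(C,α)`-Cesàro bounded on a reflexive complex Banach
space `X` (reflexivity: the canonical inclusion into the double dual is surjective). Then
`T` is `(C,α)`-mean ergodic: `(M_T^α(n) x)` converges for every `x ∈ X`. -/
theorem stmt11 {X : Type*} [NormedAddCommGroup X] [NormedSpace ℂ X] [CompleteSpace X]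
    (hrefl : Function.Surjective (NormedSpace.inclusionInDoubleDual ℂ X))
    (α : ℝ) (hα : 0 < α) (T : X →L[ℂ] X) (hT : AbsCesaroBounded α T) :
    ∀ x : X, ∃ y : X, Tendsto (fun n : ℕ => (cesMean α T n) x) atTop (nhds y) := by
  intro x
  obtain ⟨C, hC, hT0⟩ := hT
  have hK : ∀ n, 0 < cesKernel (α + 1) n := ck_pos (by linarith)
  have hT : ∀ (n : ℕ) (x : X), ∑ m ∈ Finset.range (n + 1), cesKernel α m * ‖(T ^ (n - m)) x‖
      ≤ C * cesKernel (α + 1) n * ‖x‖ := by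
    intro n x
    have h := hT0 n x
    rw [← Finset.sum_range_reflect, inv_mul_le_iff₀ (hK n)] at h
    calc _ = _ := ?_
      _ ≤ _ := h
      _ = _ := by ring
    refine Finset.sum_congr rfl fun m hm => ?_
    have hm' : m ≤ n := by simpa [Nat.lt_succ_iff] using hm
    have e1 : n + 1 - 1 - m = n - m := by omega
    have e2 : n - (n - m) = m := by omega
    rw [e1, e2]
  have hM : ∀ n x, ‖cesMean α T n x‖ ≤ C * ‖x‖ := by
    intro n x
    rw [cesMean_apply', norm_smul, Complex.norm_real,
      Real.norm_of_nonneg (inv_nonneg.2 (hK n).le), inv_mul_le_iff₀ (hK n)]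
    calc _ ≤ _ := norm_sum_le _ _
      _ = ∑ m ∈ Finset.range (n + 1), cesKernel α m * ‖(T ^ (n - m)) x‖ := by
        refine Finset.sum_congr rfl fun m _ => ?_
        rw [norm_smul, Complex.norm_real, Real.norm_of_nonneg (ck_pos hα m).le]
      _ ≤ _ := hT n x
      _ = _ := by ring
  have hcomm : ∀ n x, cesMean α T n (T x) = T (cesMean α T n x) := by
    intro n x
    simp only [cesMean_apply', map_smul, map_sum]
    congr 1
    refine Finset.sum_congr rfl fun m _ => ?_
    rw [← ContinuousLinearMap.mul_apply, ← ContinuousLinearMap.mul_apply,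
      ← pow_succ, ← pow_succ']
  have hd := mean_diff hα T hC hT
  obtain ⟨y, hy⟩ := weak_cluster hrefl (fun n => cesMean α T n x) (C * ‖x‖) (fun n => hM n x)
    (Ultrafilter.of atTop)
  have hU : ((Ultrafilter.of atTop : Ultrafilter ℕ) : Filter ℕ) ≤ atTop := Ultrafilter.of_le _
  have hTy : T y = y := by
    rw [SeparatingDual.eq_iff_forall_dual_eq (R := ℂ)]
    intro f
    have h1 := (hy f).sub (hy (f.comp T))
    have h2 : Tendsto (fun n => f (cesMean α T n (x - T x))) (Ultrafilter.of atTop : Ultrafilter ℕ)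
        (nhds (f 0)) := ((f.continuous.tendsto 0).comp (hd x)).mono_left hU
    have h3 := tendsto_nhds_unique h1 (h2.congr fun n => by simp [hcomm])
    rw [map_zero, sub_eq_zero] at h3
    exact h3.symm
  have hTjy : ∀ j, (T ^ j) y = y := by
    intro j
    induction j with
    | zero => simp
    | succ j ih => rw [pow_succ, ContinuousLinearMap.mul_apply, hTy, ih]
  have hMy : ∀ n, cesMean α T n y = y := fun n =>
    mean_fix hα T (ContinuousLinearMap.id ℂ X) y hTjy n
  let S : Submodule ℂ X := LinearMap.range ((ContinuousLinearMap.id ℂ X - T : X →L[ℂ] X) : X →ₗ[ℂ] X)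
  have hcl : x - y ∈ S.topologicalClosure := by
    refine mem_closure_of_dual S _ fun f hf => ?_
    have hfT : ∀ z, f (T z) = f z := by
      intro z
      have := hf (z - T z) ⟨z, by simp⟩
      rw [map_sub, sub_eq_zero] at this
      exact this.symm
    have hj : ∀ j, f ((T ^ j) x) = f x := by
      intro j
      induction j with
      | zero => simp
      | succ j ih => rw [pow_succ', ContinuousLinearMap.mul_apply, hfT, ih]
    have h1 := (hy f).congr (fun n => mean_fix hα T f x hj n)
    rw [map_sub, tendsto_nhds_unique h1 tendsto_const_nhds, sub_self]
  refine ⟨y, ?_⟩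
  rw [Metric.tendsto_atTop]
  intro ε hε
  obtain ⟨s, ⟨z, hz⟩, hs⟩ := Metric.mem_closure_iff.1 hcl (ε / (2 * C)) (by positivity)
  have hz' : z - T z = s := by simpa using hz
  obtain ⟨N, hN⟩ := Metric.tendsto_atTop.1 (hd z) (ε / 2) (by positivity)
  refine ⟨N, fun n hn => ?_⟩
  have h1 := hN n hn
  rw [dist_zero_right, hz'] at h1
  have h2 : cesMean α T n x - y = cesMean α T n s + cesMean α T n (x - y - s) := by
    rw [map_sub, map_sub, hMy]; abel
  rw [dist_eq_norm, h2]
  have h3 := hM n (x - y - s)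
  rw [dist_eq_norm, lt_div_iff₀ (by positivity)] at hs
  have h4 := norm_add_le (cesMean α T n s) (cesMean α T n (x - y - s))
  linarith
end

section
/- Let 1 ≤ α < 2 and let T be a Kreiss bounded operator on a complex Banach space X such that the part of the spectrum of T on the unit circle has Lebesgue measure zero, i.e. the set {θ ∈ [0, 2π) : e^{iθ} ∈ σ(T)} has Lebesgue measure zero. Then ‖M_T^α(n+1) − M_T^α(n)‖ → 0 as n → ∞. -/
open Filter
open scoped ENNReal

/-- `T` is Kreiss bounded: there is `C > 0` such that every `λ ∈ ℂ` with `|λ| > 1` lies in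
the resolvent set of `T` and `‖(λ - T)⁻¹‖ ≤ C/(|λ| - 1)`. -/
def KreissBounded {X : Type*} [NormedAddCommGroup X] [NormedSpace ℂ X] [CompleteSpace X]
    (T : X →L[ℂ] X) : Prop :=
  ∃ C : ℝ, 0 < C ∧ ∀ lam : ℂ, 1 < ‖lam‖ →
    lam ∈ resolventSet ℂ T ∧
      ‖Ring.inverse (algebraMap ℂ (X →L[ℂ] X) lam - T)‖ ≤ C / (‖lam‖ - 1)

open MeasureTheory Set in
/-- Norm bound on the powers, from the zero-measure spectrum. -/
theorem pow_norm_div_tendsto {X : Type*} [NormedAddCommGroup X] [NormedSpace ℂ X] [CompleteSpace X]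
    (T : X →L[ℂ] X) (hT : KreissBounded T)
    (hσ : MeasureTheory.volume
        {θ : ℝ | θ ∈ Set.Ico (0 : ℝ) (2 * Real.pi) ∧
          Complex.exp (θ * Complex.I) ∈ spectrum ℂ T} = 0) :
    Tendsto (fun n : ℕ => ‖T ^ n‖ / (n + 1 : ℝ)) atTop (nhds 0) := by
  obtain ⟨C, hC, hK⟩ := hT
  set f : ℂ → (X →L[ℂ] X) := fun z => Ring.inverse (1 - z • T) with hf
  have hfac : ∀ z : ℂ, z ≠ 0 →
      1 - z • T = z • (algebraMap ℂ (X →L[ℂ] X) z⁻¹ - T) := by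
    intro z hz
    rw [smul_sub, Algebra.algebraMap_eq_smul_one, smul_smul, mul_inv_cancel₀ hz, one_smul]
  have hunit' : ∀ z : ℂ, z ≠ 0 → z⁻¹ ∉ spectrum ℂ T → IsUnit (1 - z • T) := by
    intro z hz h
    rw [spectrum.notMem_iff] at h
    rw [hfac z hz]
    exact h.smul (Units.mk0 z hz)
  have hunit : ∀ z : ℂ, ‖z‖ < 1 → IsUnit (1 - z • T) := by
    intro z hz
    by_cases h0 : z = 0
    · simp [h0]
    · apply hunit' z h0
      have : 1 < ‖z⁻¹‖ := by
        rw [norm_inv]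
        exact (one_lt_inv₀ (norm_pos_iff.mpr h0)).mpr hz
      exact fun h => h (hK _ this).1
  have hdiff : ∀ z : ℂ, IsUnit (1 - z • T) → DifferentiableAt ℂ f z := by
    intro z hz
    have H₁ : Differentiable ℂ fun w : ℂ => 1 - w • T := (differentiable_id.smul_const T).const_sub 1
    exact DifferentiableAt.comp z (differentiableAt_inverse hz) H₁.differentiableAt
  have hbound : ∀ z : ℂ, z ≠ 0 → ‖z‖ < 1 → ‖f z‖ ≤ C / (1 - ‖z‖) := by
    intro z h0 hz
    have hzp : 0 < ‖z‖ := norm_pos_iff.mpr h0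
    have h1 : 1 < ‖z⁻¹‖ := by
      rw [norm_inv]
      exact (one_lt_inv₀ hzp).mpr hz
    obtain ⟨hr, hb⟩ := hK _ h1
    have hu : IsUnit (algebraMap ℂ (X →L[ℂ] X) z⁻¹ - T) := hr
    have e : f z = z⁻¹ • Ring.inverse (algebraMap ℂ (X →L[ℂ] X) z⁻¹ - T) := by
      have h2 : (1 - z • T) * (z⁻¹ • Ring.inverse (algebraMap ℂ (X →L[ℂ] X) z⁻¹ - T)) = 1 := by
        rw [hfac z h0, smul_mul_smul_comm, mul_inv_cancel₀ h0, one_smul,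
          Ring.mul_inverse_cancel _ hu]
      calc f z = f z * ((1 - z • T) * (z⁻¹ • Ring.inverse (algebraMap ℂ (X →L[ℂ] X) z⁻¹ - T))) := by
            rw [h2, mul_one]
        _ = _ := by rw [← mul_assoc, hf, Ring.inverse_mul_cancel _ (hunit z hz), one_mul]
    rw [e, norm_smul]
    calc ‖z⁻¹‖ * _ ≤ ‖z⁻¹‖ * (C / (‖z⁻¹‖ - 1)) := by gcongr
      _ = C / (1 - ‖z‖) := by
        rw [norm_inv]
        have : 1 - ‖z‖ ≠ 0 := by linarith
        have : ‖z‖⁻¹ - 1 ≠ 0 := by rw [norm_inv] at h1; linarith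
        field_simp
  -- Cauchy estimate
  have hcauchy : ∀ (n : ℕ) (R : ℝ), 0 < R → R < 1 →
      ‖T ^ n‖ ≤ ((2 * Real.pi)⁻¹ * ∫ θ : ℝ in 0..2 * Real.pi, ‖f (circleMap 0 R θ)‖) * |R|⁻¹ ^ n := by
    intro n R h0 h1
    have hd : DifferentiableOn ℂ f (Metric.closedBall 0 (⟨R, h0.le⟩ : NNReal)) := by
      intro z hz
      have : ‖z‖ ≤ R := by simpa using hz
      exact (hdiff z (hunit z (by linarith))).differentiableWithinAt
    have H₁ := hd.hasFPowerSeriesOnBall (by exact_mod_cast h0)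
    have H₂ := spectrum.hasFPowerSeriesOnBall_inverse_one_sub_smul ℂ T
    have H := H₂.hasFPowerSeriesAt.eq_formalMultilinearSeries H₁.hasFPowerSeriesAt
    have := norm_cauchyPowerSeries_le f 0 R n
    have e := congrFun H n
    have e2 : ‖T ^ n‖ = ‖cauchyPowerSeries f 0 R n‖ := by
      rw [← ContinuousMultilinearMap.norm_mkPiRing (𝕜 := ℂ) (ι := Fin n) (T ^ n), e]
      rfl
    rw [e2]; exact this
  set R : ℕ → ℝ := fun n => ((n : ℝ) + 1) / (n + 2) with hR
  have hR0 : ∀ n, 0 < R n := fun n => by simp only [hR]; positivity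
  have hR1 : ∀ n, R n < 1 := fun n => by
    simp only [hR]; rw [div_lt_one (by positivity)]; linarith
  have hRl : Tendsto R atTop (nhds 1) := by
    have h := (tendsto_one_div_add_atTop_nhds_zero_nat (𝕜 := ℝ)).comp (tendsto_add_atTop_nat 1)
    have h2 := h.const_sub 1
    simp only [sub_zero] at h2
    refine h2.congr fun n => ?_
    simp only [Function.comp, hR]
    push_cast
    field_simp
    ring
  have hRp : ∀ n, |R n|⁻¹ ^ n ≤ Real.exp 1 := by
    intro n
    rw [abs_of_pos (hR0 n)]
    have : (R n)⁻¹ = 1 / ((n : ℝ) + 1) + 1 := by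
      simp only [hR]; field_simp; ring
    rw [this]
    calc (1 / ((n : ℝ) + 1) + 1) ^ n ≤ (Real.exp (1 / ((n : ℝ) + 1))) ^ n := by
          gcongr; exact Real.add_one_le_exp _
      _ = Real.exp (n * (1 / ((n : ℝ) + 1))) := by rw [← Real.exp_nat_mul]
      _ ≤ Real.exp 1 := by
          gcongr
          rw [mul_one_div, div_le_one (by positivity)]; linarith
  have hnorm : ∀ n θ, ‖circleMap 0 (R n) θ‖ = R n := fun n θ => by
    rw [norm_circleMap_zero, abs_of_pos (hR0 n)]
  have hne : ∀ n θ, circleMap 0 (R n) θ ≠ 0 := fun n θ h => by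
    have := hnorm n θ; rw [h, norm_zero] at this; linarith [hR0 n]
  have hlim : Tendsto (fun n : ℕ => ∫ θ : ℝ in 0..2 * Real.pi,
      ‖f (circleMap 0 (R n) θ)‖ / ((n : ℝ) + 1)) atTop (nhds (∫ θ : ℝ in 0..2 * Real.pi, (0 : ℝ))) := by
    apply intervalIntegral.tendsto_integral_filter_of_dominated_convergence (fun _ => 2 * C)
    · refine Eventually.of_forall fun n => ?_
      apply Continuous.aestronglyMeasurable
      apply Continuous.div_const
      apply Continuous.norm
      rw [continuous_iff_continuousAt]
      intro θ
      have h1 : ContinuousAt f (circleMap 0 (R n) θ) :=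
        (hdiff _ (hunit _ (by rw [hnorm]; exact hR1 n))).continuousAt
      exact ContinuousAt.comp (f := circleMap 0 (R n)) h1 (continuous_circleMap 0 (R n)).continuousAt
    · refine Eventually.of_forall fun n => Eventually.of_forall fun θ _ => ?_
      have := hbound (circleMap 0 (R n) θ) (hne n θ) (by rw [hnorm]; exact hR1 n)
      rw [hnorm] at this
      have e : 1 - R n = 1 / ((n : ℝ) + 2) := by simp only [hR]; field_simp; ring
      rw [e] at this
      rw [Real.norm_of_nonneg (by positivity), div_le_iff₀ (by positivity)]
      refine this.trans ?_
      rw [div_div_eq_mul_div, div_one]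
      nlinarith [mul_nonneg hC.le (Nat.cast_nonneg (α := ℝ) n)]
    · exact intervalIntegrable_const
    · have hmp := (volume : Measure ℝ).measurePreserving_sub_left (2 * Real.pi)
      have hnull := hmp.quasiMeasurePreserving.preimage_null hσ
      have hae := compl_mem_ae_iff.mpr hnull
      filter_upwards [hae] with θ hθ hmem
      rw [uIoc_of_le (by positivity)] at hmem
      have hns : (Complex.exp (θ * Complex.I))⁻¹ ∉ spectrum ℂ T := by
        intro h
        apply hθ
        refine ⟨⟨by linarith [hmem.2], by linarith [hmem.1]⟩, ?_⟩
        convert h using 1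
        rw [← Complex.exp_neg]
        push_cast
        rw [sub_mul, Complex.exp_sub, Complex.exp_two_pi_mul_I, Complex.exp_neg, one_div]
      have hu := hunit' _ (Complex.exp_ne_zero _) hns
      have hc := (hdiff _ hu).continuousAt
      have ht : Tendsto (fun n => circleMap 0 (R n) θ) atTop (nhds (Complex.exp (θ * Complex.I))) := by
        have h1 : Tendsto (fun n => ((R n : ℝ) : ℂ)) atTop (nhds ((1 : ℝ) : ℂ)) :=
          (Complex.continuous_ofReal.tendsto 1).comp hRl
        have h2 := h1.mul_const (Complex.exp (θ * Complex.I))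
        simpa [circleMap] using h2
      have h3 := (hc.tendsto.comp ht).norm
      have h4 := h3.mul (tendsto_one_div_add_atTop_nhds_zero_nat (𝕜 := ℝ))
      simpa [div_eq_mul_inv] using h4
  simp only [intervalIntegral.integral_zero] at hlim
  have hfin := hlim.const_mul ((2 * Real.pi)⁻¹ * Real.exp 1)
  rw [mul_zero] at hfin
  refine squeeze_zero (fun n => by positivity) (fun n => ?_) hfin
  rw [intervalIntegral.integral_div, div_eq_mul_inv, div_eq_mul_inv, ← mul_assoc]
  gcongr
  refine (hcauchy n (R n) (hR0 n) (hR1 n)).trans ?_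
  have hI : 0 ≤ ∫ θ : ℝ in 0..2 * Real.pi, ‖f (circleMap 0 (R n) θ)‖ :=
    intervalIntegral.integral_nonneg (by positivity) fun _ _ => norm_nonneg _
  calc _ ≤ ((2 * Real.pi)⁻¹ * ∫ θ : ℝ in 0..2 * Real.pi, ‖f (circleMap 0 (R n) θ)‖) * Real.exp 1 := by
        gcongr; exact hRp n
    _ = _ := by ring

theorem cesKernel_pos {α : ℝ} (h : 0 < α) (n : ℕ) : 0 < cesKernel α n := by
  unfold cesKernel
  have := Real.Gamma_pos_of_pos (show 0 < α + n by positivity)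
  have := Real.Gamma_pos_of_pos h
  have := Real.Gamma_pos_of_pos (show (0 : ℝ) < n + 1 by positivity)
  positivity

theorem cesKernel_succ {α : ℝ} (h : 0 < α) (n : ℕ) :
    cesKernel α (n + 1) = cesKernel α n * ((α + n) / (n + 1)) := by
  unfold cesKernel
  have h1 := Real.Gamma_add_one (show α + n ≠ 0 by positivity)
  have h2 := Real.Gamma_add_one (show (n : ℝ) + 1 ≠ 0 by positivity)
  have := Real.Gamma_pos_of_pos h
  have := Real.Gamma_pos_of_pos (show (0 : ℝ) < n + 1 by positivity)
  push_cast
  rw [← add_assoc, h1, h2]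
  field_simp

theorem cesKernel_zero {α : ℝ} (h : 0 < α) : cesKernel α 0 = 1 := by
  unfold cesKernel
  have := Real.Gamma_pos_of_pos h
  simp [this.ne']

theorem cesKernel_add_one {α : ℝ} (h : 0 < α) (n : ℕ) :
    cesKernel (α + 1) n * α = cesKernel α n * (α + n) := by
  unfold cesKernel
  have h1 := Real.Gamma_add_one (show α + n ≠ 0 by positivity)
  have h2 := Real.Gamma_add_one h.ne'
  have := Real.Gamma_pos_of_pos h
  have := Real.Gamma_pos_of_pos (show (0 : ℝ) < n + 1 by positivity)
  rw [add_right_comm, h1, h2]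
  field_simp

theorem cesKernel_sum {α : ℝ} (h : 0 < α) (n : ℕ) :
    ∑ j ∈ Finset.range (n + 1), cesKernel α j = cesKernel (α + 1) n := by
  induction n with
  | zero => simp [cesKernel_zero h, cesKernel_zero (show 0 < α + 1 by positivity)]
  | succ n ih =>
    rw [Finset.sum_range_succ, ih, cesKernel_succ h, cesKernel_succ (show 0 < α + 1 by positivity)]
    have := cesKernel_add_one h n
    have h3 : cesKernel (α + 1) n = cesKernel α n * (α + n) / α := by
      rw [← this]; field_simp
    rw [h3]
    field_simp
    ring

theorem cesKernel_sum_rev {α : ℝ} (h : 0 < α) (n : ℕ) :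
    ∑ j ∈ Finset.range (n + 1), cesKernel α (n - j) = cesKernel (α + 1) n := by
  rw [← cesKernel_sum h, ← Finset.sum_range_reflect (fun j => cesKernel α j)]
  simp

theorem cesKernel_mono {α : ℝ} (h : 1 ≤ α) (n : ℕ) :
    cesKernel α n ≤ cesKernel α (n + 1) := by
  rw [cesKernel_succ (by linarith)]
  apply le_mul_of_one_le_right (cesKernel_pos (by linarith) n).le
  rw [one_le_div (by positivity)]
  linarith

/-- The difference of consecutive means, bounded by the largest power norm. -/
theorem diff_bound_s14 {X : Type*} [NormedAddCommGroup X] [NormedSpace ℂ X] [CompleteSpace X]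
    (α : ℝ) (hα1 : 1 ≤ α) (T : X →L[ℂ] X) (n : ℕ) (A : ℝ)
    (hA : ∀ j ≤ n + 1, ‖T ^ j‖ ≤ A) :
    ‖cesMean α T (n + 1) - cesMean α T n‖ ≤ 2 * α * A / (n + 1) := by
  have hα : 0 < α := by linarith
  have hα' : 0 < α + 1 := by linarith
  have hA0 : 0 ≤ A := (norm_nonneg _).trans (hA 0 (by omega))
  set S : ℕ → (X →L[ℂ] X) := fun n =>
    ∑ j ∈ Finset.range (n + 1), ((cesKernel α (n - j) : ℝ) : ℂ) • T ^ j with hS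
  set K := cesKernel (α + 1) n with hK
  have hKp : 0 < K := cesKernel_pos hα' n
  set K' := cesKernel (α + 1) (n + 1) with hK'
  have hKp' : 0 < K' := cesKernel_pos hα' (n + 1)
  have hSn : ‖S n‖ ≤ A * K := by
    calc ‖S n‖ ≤ ∑ j ∈ Finset.range (n + 1), cesKernel α (n - j) * A := by
          apply norm_sum_le_of_le
          intro j hj
          have hp := (cesKernel_pos hα (n - j)).le
          rw [norm_smul, Complex.norm_real, Real.norm_of_nonneg hp]
          gcongr
          exact hA j (by simp at hj; omega)
      _ = A * K := by rw [← Finset.sum_mul, cesKernel_sum_rev hα, mul_comm]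
  have hdS : ‖S (n + 1) - S n‖ ≤ A * cesKernel α (n + 1) := by
    have e : S (n + 1) - S n = ∑ j ∈ Finset.range (n + 1),
        ((cesKernel α (n - j + 1) - cesKernel α (n - j) : ℝ) : ℂ) • T ^ j + T ^ (n + 1) := by
      simp only [hS]
      rw [Finset.sum_range_succ _ (n + 1), add_sub_right_comm, ← Finset.sum_sub_distrib]
      congr 1
      · apply Finset.sum_congr rfl
        intro j hj
        have : n + 1 - j = n - j + 1 := by simp at hj; omega
        rw [this, ← sub_smul]; push_cast; rfl
      · simp [cesKernel_zero hα]
    rw [e]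
    have h1 : ‖∑ j ∈ Finset.range (n + 1),
        ((cesKernel α (n - j + 1) - cesKernel α (n - j) : ℝ) : ℂ) • T ^ j‖ ≤
        ∑ j ∈ Finset.range (n + 1), (cesKernel α (n - j + 1) - cesKernel α (n - j)) * A := by
      apply norm_sum_le_of_le
      intro j hj
      have hp := sub_nonneg.mpr (cesKernel_mono hα1 (n - j))
      rw [norm_smul, Complex.norm_real, Real.norm_of_nonneg hp]
      gcongr
      exact hA j (by simp at hj; omega)
    have h2 : ∑ j ∈ Finset.range (n + 1), (cesKernel α (n - j + 1) - cesKernel α (n - j))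
        = cesKernel α (n + 1) - 1 := by
      rw [← cesKernel_zero hα, ← Finset.sum_range_sub, ← Finset.sum_range_reflect
        (fun j => cesKernel α (j + 1) - cesKernel α j)]
      simp
    rw [← Finset.sum_mul, h2] at h1
    calc _ ≤ _ := norm_add_le _ _
      _ ≤ (cesKernel α (n + 1) - 1) * A + A := add_le_add h1 (hA _ le_rfl)
      _ = _ := by ring
  have hrec : K' = K * ((α + 1 + n) / (n + 1)) := cesKernel_succ hα' n
  have hrat : cesKernel α (n + 1) = K' * (α / (α + n + 1)) := by
    have := cesKernel_add_one hα (n + 1)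
    push_cast at this
    field_simp
    linarith
  have hdecomp : cesMean α T (n + 1) - cesMean α T n =
      ((K'⁻¹ : ℝ) : ℂ) • (S (n + 1) - S n) - ((K⁻¹ - K'⁻¹ : ℝ) : ℂ) • S n := by
    simp only [cesMean, hS]
    push_cast
    module
  have hKle : K'⁻¹ ≤ K⁻¹ := by
    gcongr
    exact cesKernel_mono (by linarith) n
  rw [hdecomp]
  calc _ ≤ _ := norm_sub_le _ _
    _ ≤ K'⁻¹ * (A * cesKernel α (n + 1)) + (K⁻¹ - K'⁻¹) * (A * K) := by
      have hp := sub_nonneg.mpr hKle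
      rw [norm_smul, norm_smul, Complex.norm_real, Complex.norm_real,
        Real.norm_of_nonneg (inv_pos.mpr hKp').le, Real.norm_of_nonneg hp]
      gcongr
    _ = 2 * α * A / (α + n + 1) := by
      rw [hrat]
      have h1 : K'⁻¹ * (A * (K' * (α / (α + n + 1)))) = α * A / (α + n + 1) := by
        field_simp
      have h2 : (K⁻¹ - K'⁻¹) * (A * K) = α * A / (α + n + 1) := by
        rw [hrec]
        have : α + 1 + n = α + n + 1 := by ring
        rw [this]
        field_simp
        ring
      rw [h1, h2]; ring
    _ ≤ 2 * α * A / (n + 1) := by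
      gcongr; linarith

/-- Let `1 ≤ α < 2` and `T` Kreiss bounded on a complex Banach space with
`m({θ ∈ [0,2π) : e^{iθ} ∈ σ(T)}) = 0`. Then `‖M_T^α(n+1) - M_T^α(n)‖ → 0`. -/
theorem stmt14 {X : Type*} [NormedAddCommGroup X] [NormedSpace ℂ X] [CompleteSpace X]
    (α : ℝ) (hα1 : 1 ≤ α) (hα2 : α < 2) (T : X →L[ℂ] X) (hT : KreissBounded T)
    (hσ : MeasureTheory.volume
        {θ : ℝ | θ ∈ Set.Ico (0 : ℝ) (2 * Real.pi) ∧
          Complex.exp (θ * Complex.I) ∈ spectrum ℂ T} = 0) :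
    Tendsto (fun n : ℕ => ‖cesMean α T (n + 1) - cesMean α T n‖) atTop (nhds 0) := by
  have hlim := pow_norm_div_tendsto T hT hσ
  rw [Metric.tendsto_atTop]
  intro ε hε
  -- powers are eventually below `δ (n+1)`
  set δ := ε / (8 * α) with hδ
  have hα : 0 < α := by linarith
  have hδp : 0 < δ := by positivity
  obtain ⟨N, hN⟩ := (Metric.tendsto_atTop.mp hlim) δ hδp
  set B := ∑ j ∈ Finset.range N, ‖T ^ j‖ with hB
  have hB0 : 0 ≤ B := Finset.sum_nonneg fun _ _ => norm_nonneg _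
  obtain ⟨M, hM⟩ := exists_nat_gt (B / δ)
  rw [div_lt_iff₀ hδp] at hM
  refine ⟨M, fun n hn => ?_⟩
  have hnM : (M : ℝ) ≤ n := by exact_mod_cast hn
  have hA : ∀ j ≤ n + 1, ‖T ^ j‖ ≤ δ * (n + 2) := by
    intro j hj
    by_cases hjN : j < N
    · have h1 : ‖T ^ j‖ ≤ B :=
        Finset.single_le_sum (f := fun j => ‖T ^ j‖) (fun _ _ => norm_nonneg _)
          (Finset.mem_range.mpr hjN)
      nlinarith
    · have h1 := hN j (by omega)
      rw [Real.dist_eq, sub_zero, abs_of_nonneg (by positivity), div_lt_iff₀ (by positivity)] at h1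
      have h2 : (j : ℝ) ≤ n + 1 := by exact_mod_cast hj
      nlinarith
  have := diff_bound_s14 α hα1 T n _ hA
  rw [Real.dist_eq, sub_zero, abs_of_nonneg (norm_nonneg _)]
  refine this.trans_lt ?_
  rw [div_lt_iff₀ (by positivity), hδ]
  have e : 2 * α * (ε / (8 * α) * ((n : ℝ) + 2)) = ε * (n + 2) / 4 := by field_simp; ring
  rw [e]
  nlinarith [mul_nonneg hε.le (Nat.cast_nonneg (α := ℝ) n)]
end
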